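/- Let p be analytic on 𝔻 with p(0) = 1 and p(z) ≠ 0 for all z ∈ 𝔻, and let β ≥ ((e + 1)/e)·Σ_{n=1}^∞ 1/(n!·n) (≈ 1.80273) be a real number. If the function z ↦ 1 + β·z·p'(z)/p(z)² is subordinate to e^z, then p(z) is subordinate to ℘(z) = 1 + z e^z. -/

import Mathlib

open Complex Metric

/-- `F` is subordinate to `G` on the unit disk `𝔻`. -/
def Subordinate (F G : ℂ → ℂ) : Prop :=
  ∃ ω : ℂ → ℂ, AnalyticOn ℂ ω (ball (0 : ℂ) 1) ∧ ω 0 = 0 ∧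
    (∀ z ∈ ball (0 : ℂ) 1, ω z ∈ ball (0 : ℂ) 1) ∧
    ∀ z ∈ ball (0 : ℂ) 1, F z = G (ω z)


lemma aux_ysin (y : ℝ) : y ^ 2 * (1 - y ^ 2 / 6) ≤ y * Real.sin y := by
  rcases le_total 0 y with h | h
  · have := Real.sin_ge_sub_cube h
    nlinarith
  · have := Real.sin_ge_sub_cube (neg_nonneg.2 h)
    rw [Real.sin_neg] at this
    nlinarith

set_option maxHeartbeats 1000000 in
lemma aux_key (x y : ℝ) (h : x ^ 2 + y ^ 2 = 1) :
    (Real.exp 1) ^ 2 * (1 + 2 * Real.exp x * (x * Real.cos y - y * Real.sin y) + Real.exp x ^ 2)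
      ≤ Real.exp x ^ 2 * (1 + Real.exp 1) ^ 2 ∨
    14 * Real.exp x ^ 2 + 19 * Real.exp x * (x * Real.cos y - y * Real.sin y) + 5 < 0 := by
  have e1 := Real.exp_one_gt_d9
  have e2 := Real.exp_one_lt_d9
  have hs := aux_ysin y
  have hc := Real.cos_le_one y
  have hc' := @Real.one_sub_sq_div_two_le_cos y
  have hu : y ^ 2 = 1 - x ^ 2 := by linarith
  have hx1 : x ≤ 1 := by nlinarith [sq_nonneg y]
  have hx2 : -1 ≤ x := by nlinarith [sq_nonneg y]
  rw [hu] at hs hc'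
  set C := x * Real.cos y - y * Real.sin y with hC
  have hk0 := Real.exp_pos x
  have hk1 := Real.add_one_le_exp x
  rcases le_total 0 x with h0 | h0
  · left
    have hCb : C ≤ 1 - (14/9) * (1 - x) := by
      have : x * Real.cos y ≤ x := by nlinarith
      have h3 : (1 - x^2) * (5/6) ≤ (1 - x^2) * (1 - (1 - x^2)/6) := by
        apply mul_le_mul_of_nonneg_left <;> nlinarith
      nlinarith
    have hb := Real.abs_exp_sub_one_sub_id_le (x := 1 - x) (by rw [abs_le]; constructor <;> linarith)
    have hm := Real.add_one_le_exp (x - 1)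
    have hmul : Real.exp (1 - x) * Real.exp (x - 1) = 1 := by rw [← Real.exp_add]; simp
    have hk : Real.exp x = Real.exp 1 * Real.exp (x - 1) := by rw [← Real.exp_add]; ring_nf
    rw [hk]
    rw [abs_le] at hb
    set m := Real.exp (x - 1)
    set n := Real.exp (1 - x)
    set E := Real.exp 1
    have hm0 : 0 < m := Real.exp_pos _
    -- n - m ≤ 3 (1-x)
    have h3 : n - m ≤ 3 * (1 - x) := by nlinarith
    have h4 : 2 * E * C ≤ 2 * E * m - (n - m) := by nlinarith
    have h5 : 2 * E * C * m ≤ 2 * E * m * m - (1 - m * m) := by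
      have := mul_le_mul_of_nonneg_right h4 hm0.le
      linarith [hmul]
    have h6 : 1 + 2 * (E * m) * C + (E * m)^2 ≤ m ^ 2 * (1 + E)^2 := by nlinarith
    have := mul_le_mul_of_nonneg_left h6 (sq_nonneg E)
    linarith
  rcases le_total (-1/2) x with h1 | h1
  · left
    have hxc : x * Real.cos y ≤ x * (1 - (1 - x^2)/2) := mul_le_mul_of_nonpos_left hc' h0
    have hCb : C ≤ -4/5 := by nlinarith [mul_nonneg (neg_nonneg.2 h0) (by linarith : 0 ≤ x + 1/2)]
    have hkC : Real.exp x * C ≤ Real.exp x * (-4/5) := mul_le_mul_of_nonneg_left hCb hk0.le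
    set k := Real.exp x
    have hk : 1/2 ≤ k := by linarith
    set E := Real.exp 1
    have hE : (4/5) * E^2 ≤ 1 + 2 * E := by nlinarith
    have h6 : 1 + 2 * k * C ≤ (4/5) * k^2 := by nlinarith
    have h7 := mul_le_mul_of_nonneg_left h6 (sq_nonneg E)
    have h8 := mul_le_mul_of_nonneg_left hE (sq_nonneg k)
    linarith
  · right
    obtain ⟨w, rfl⟩ : ∃ w, x = -1 + w := ⟨x + 1, by ring⟩
    have hw0 : 0 ≤ w := by linarith
    have hw1 : w ≤ 1/2 := by linarith
    have hxc : (-1 + w) * Real.cos y ≤ (-1+w) * (1 - (1 - (-1+w)^2)/2) :=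
      mul_le_mul_of_nonpos_left hc' h0
    have hCb : C ≤ -1 + w^2/6 := by
      nlinarith [pow_nonneg hw0 3, mul_nonneg (pow_nonneg hw0 3) (by linarith : 0 ≤ 1/2 - w)]
    have hkC := mul_le_mul_of_nonneg_left hCb hk0.le
    have hkl : (367/1000) * (1 + w) ≤ Real.exp (-1 + w) := by
      have a1 : Real.exp (-1 + w) * Real.exp 1 = Real.exp w := by rw [← Real.exp_add]; ring_nf
      have a2 := Real.add_one_le_exp w
      nlinarith
    have hku : Real.exp (-1 + w) ≤ 5/8 := by
      have a1 : Real.exp (-1 + w) * Real.exp (1 - w) = 1 := by rw [← Real.exp_add]; simp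
      have a2 : 8/5 ≤ Real.exp (1 - w) := by
        have := Real.quadratic_le_exp_of_nonneg (x := 1 - w) (by linarith)
        nlinarith
      nlinarith
    set k := Real.exp (-1 + w)
    have hq : (k - 367/1000 * (1+w)) * (5/8 - k) ≥ 0 := mul_nonneg (by linarith) (by linarith)
    have hw2 : w^2 ≤ w/2 := by nlinarith
    have hkC2 : k * C ≤ k * (-1 + w/12) := by nlinarith
    have hkw : 0 ≤ k * w := by positivity
    have : 14 * k^2 - 19 * k * (1 - w/12) + 5 < 0 := by
      nlinarith [mul_nonneg hw0 (by linarith : 0 ≤ 5/8 - k), mul_nonneg hw0 (by linarith : 0 ≤ k - 367/1000 * (1+w)), mul_nonneg (by linarith : 0 ≤ 1/2 - w) (by linarith : 0 ≤ 5/8 - k)]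
    nlinarith

lemma aux_beta (β : ℝ) 
    (hβ : ((Real.exp 1 + 1) / Real.exp 1) *
      (∑' n : ℕ, 1 / ((Nat.factorial (n + 1) : ℝ) * ((n : ℝ) + 1))) ≤ β)
    (hs : Summable fun n : ℕ => 1 / ((Nat.factorial (n + 1) : ℝ) * ((n : ℝ) + 1))) : 9/5 ≤ β := by
  have h1 := hs.sum_le_tsum (Finset.range 4) (fun i _ => by positivity)
  have e2 := Real.exp_one_lt_d9
  have e1 := Real.exp_one_gt_d9
  have h4 : ∑ n ∈ Finset.range 4, 1 / ((Nat.factorial (n + 1) : ℝ) * ((n : ℝ) + 1)) = 379/288 := by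
    norm_num [Finset.sum_range_succ, Nat.factorial]
  rw [h4] at h1
  refine le_trans ?_ hβ
  have : (13678794/10000000 : ℝ) ≤ (Real.exp 1 + 1) / Real.exp 1 := by
    rw [le_div_iff₀ (by linarith)]; linarith
  nlinarith

lemma aux_summable : Summable fun n : ℕ => 1 / ((Nat.factorial (n + 1) : ℝ) * ((n : ℝ) + 1)) := by
  have h := (Real.summable_pow_div_factorial 1)
  refine Summable.of_nonneg_of_le (fun n => by positivity) (fun n => ?_) h
  simp only [one_pow]
  apply one_div_le_one_div_of_le (by positivity)
  have : (n.factorial : ℝ) ≤ ((n+1).factorial : ℝ) := by exact_mod_cast Nat.factorial_le (by omega)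
  have h2 : (0:ℝ) < (n+1).factorial := by positivity
  nlinarith [(Nat.cast_nonneg n : (0:ℝ) ≤ n)]

noncomputable def auxL (t : ℝ) : ℝ := ∑' n : ℕ, t ^ (n+1) / ((Nat.factorial (n + 1) : ℝ) * ((n : ℝ) + 1))

lemma auxL_deriv (t : ℝ) (ht : |t| < 2) :
    HasDerivAt auxL (∑' n : ℕ, t ^ n / (Nat.factorial (n + 1) : ℝ)) t := by
  have hsum : Summable fun n : ℕ => (2:ℝ) ^ n / (Nat.factorial (n + 1) : ℝ) := by
    refine Summable.of_nonneg_of_le (fun n => by positivity) (fun n => ?_) (Real.summable_pow_div_factorial 2)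
    apply div_le_div_of_nonneg_left (by positivity) (by positivity)
    exact_mod_cast Nat.factorial_le (by omega)
  refine hasDerivAt_tsum_of_isPreconnected (t := ball (0:ℝ) 2) (y₀ := 0) hsum isOpen_ball 
    (convex_ball _ _).isPreconnected (g' := fun (n:ℕ) y => y ^ n / (Nat.factorial (n + 1) : ℝ)) ?_ ?_ (by simp) (by simp [summable_zero]) (by simpa using ht)
  · intro n y _
    have := (hasDerivAt_pow (n+1) y).div_const ((Nat.factorial (n + 1) : ℝ) * ((n : ℝ) + 1))
    convert! this using 1
    push_cast
    field_simp
  · intro n y hy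
    rw [norm_div, norm_pow, Real.norm_natCast]
    gcongr
    simpa using (mem_ball_zero_iff.1 hy).le

lemma auxL_sum (t : ℝ) : t * (∑' n : ℕ, t ^ n / (Nat.factorial (n + 1) : ℝ)) = Real.exp t - 1 := by
  rw [← tsum_mul_left, Real.exp_eq_exp_ℝ, NormedSpace.exp_eq_tsum_div]
  have h := (Real.summable_pow_div_factorial t).sum_add_tsum_nat_add 1
  simp only [Finset.sum_range_one, pow_zero, Nat.factorial_zero, Nat.cast_one, div_one] at h
  show _ = (∑' n : ℕ, t ^ n / (n.factorial : ℝ)) - 1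
  rw [← h, add_sub_cancel_left]
  congr 1
  ext n
  ring

lemma aux_re (w : ℂ) (t : ℝ) (ht1 : t ≤ 1) (hw : ‖w‖ ≤ t) : (1 - Complex.exp w).re ≤ t := by
  have ht0 : 0 ≤ t := (norm_nonneg _).trans hw
  rw [Complex.sub_re, Complex.exp_re, Complex.one_re]
  have hn : w.re ^ 2 + w.im ^ 2 ≤ t ^ 2 := by
    have := Complex.sq_norm w
    rw [Complex.normSq_apply] at this
    nlinarith [norm_nonneg w]
  have ha := abs_le.1 ((Complex.abs_re_le_norm w).trans hw)
  have h1 := Real.add_one_le_exp w.re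
  have h2 := @Real.one_sub_sq_div_two_le_cos w.im
  set a := w.re
  set b := w.im
  have h3 : 0 ≤ 1 - b^2/2 := by nlinarith
  have h4 : (a + 1) * (1 - b^2/2) ≤ Real.exp a * Real.cos b := by
    apply mul_le_mul h1 h2 h3 (Real.exp_pos _).le
  have h5 : (a+1) * (1 - (t^2 - a^2)/2) ≤ (a+1) * (1 - b^2/2) := by
    apply mul_le_mul_of_nonneg_left <;> linarith
  have h6 : 0 ≤ (t + a) * (1 - (1 + a) * (t - a)/2) := by
    apply mul_nonneg <;> nlinarith
  nlinarith

lemma aux_norm (w : ℂ) (t ρ : ℝ) (h0 : 0 ≤ ρ) (h1 : ρ ≤ 1) (hw : ‖w‖ ≤ ρ * t) :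
    ‖1 - Complex.exp w‖ ≤ ρ * (Real.exp t - 1) := by
  have h := Complex.norm_exp_sub_sum_le_exp_norm_sub_sum w 1
  simp at h
  rw [norm_sub_rev]
  have h2 : Real.exp ‖w‖ ≤ Real.exp (ρ * t) := Real.exp_le_exp.2 hw
  have h3 := convexOn_exp.2 (Set.mem_univ t) (Set.mem_univ 0) h0 (sub_nonneg.2 h1) (by ring)
  simp at h3
  linarith

lemma aux_inj_log (u v : ℂ) (hu : u.re < 0) (hv : v.re < 0) (h : u + Complex.exp u = v + Complex.exp v) :
    u = v := by
  set d := max u.re v.re with hd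
  have hd0 : d < 0 := max_lt hu hv
  have hconv : Convex ℝ {z : ℂ | z.re ≤ d} := convex_halfSpace_re_le d
  have := hconv.norm_image_sub_le_of_norm_hasDerivWithin_le (f := Complex.exp) (f' := Complex.exp) (C := Real.exp d)
    (fun x _ => (Complex.hasDerivAt_exp x).hasDerivWithinAt)
    (fun x hx => by rw [Complex.norm_exp]; exact Real.exp_le_exp.2 hx)
    (show u.re ≤ d from le_max_left _ _) (show v.re ≤ d from le_max_right _ _)
  have h2 : Complex.exp v - Complex.exp u = u - v := by linear_combination -h
  rw [h2, norm_sub_rev] at this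
  have h3 : Real.exp d < 1 := by simpa using hd0
  by_contra hne
  have : 0 < ‖v - u‖ := norm_pos_iff.2 (sub_ne_zero.2 (Ne.symm hne))
  nlinarith

lemma aux_inj (z w : ℂ) (hz : ‖z‖ < 1) (hw : ‖w‖ < 1) (h : z * Complex.exp z = w * Complex.exp w) :
    z = w := by
  by_cases hz0 : z = 0
  · subst hz0
    symm
    simpa [Complex.exp_ne_zero] using h.symm
  by_cases hw0 : w = 0
  · subst hw0
    simpa [Complex.exp_ne_zero] using h
  have ez := Complex.exp_log hz0
  have ew := Complex.exp_log hw0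
  have h1 : Complex.exp (Complex.log z + z) = Complex.exp (Complex.log w + w) := by
    rw [Complex.exp_add, Complex.exp_add, ez, ew, h]
  obtain ⟨n, hn⟩ := Complex.exp_eq_exp_iff_exists_int.1 h1
  have h2 : Complex.exp (Complex.log w + n * (2 * Real.pi * Complex.I)) = w := by
    rw [Complex.exp_add, Complex.exp_int_mul_two_pi_mul_I, mul_one, ew]
  have h3 := aux_inj_log (Complex.log z) (Complex.log w + n * (2 * Real.pi * Complex.I))
    (by rw [Complex.log_re]; exact Real.log_neg (norm_pos_iff.2 hz0) hz)
    (by simp [Complex.log_re]; exact Real.log_neg (norm_pos_iff.2 hw0) hw)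
    (by rw [h2, ez, hn]; ring)
  rw [← ez, h3, h2]

lemma aux_ray (p ω : ℂ → ℂ) (hp : DifferentiableOn ℂ p (ball (0 : ℂ) 1))
    (hpne : ∀ z ∈ ball (0 : ℂ) 1, p z ≠ 0) (β : ℝ) (hβ : 0 < β)
    (heq : ∀ w ∈ ball (0 : ℂ) 1, 1 + (β : ℂ) * w * deriv p w / (p w) ^ 2 = Complex.exp (ω w))
    (z : ℂ) (hz : z ∈ ball (0 : ℂ) 1) (u : ℂ) (B B' : ℝ → ℝ)
    (hB : ∀ t ∈ Set.Icc (0:ℝ) 1, HasDerivAt B (B' t) t)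
    (hb : ∀ t ∈ Set.Ioo (0:ℝ) 1, (u * (1 - Complex.exp (ω (t * z)))).re ≤ β * (t * B' t)) :
    (u * ((p z)⁻¹ - (p 0)⁻¹)).re ≤ B 1 - B 0 := by
  have hmem : ∀ t ∈ Set.Icc (0:ℝ) 1, (t : ℂ) * z ∈ ball (0:ℂ) 1 := by
    intro t ht
    rw [mem_ball_zero_iff] at hz ⊢
    rw [norm_mul, Complex.norm_real, Real.norm_of_nonneg ht.1]
    nlinarith [ht.2, norm_nonneg z]
  have hder : ∀ t ∈ Set.Icc (0:ℝ) 1, HasDerivAt (fun s : ℝ => (u * (p (s * z))⁻¹).re)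
      ((u * (-(deriv p (t * z) * z) / (p (t * z)) ^ 2)).re) t := by
    intro t ht
    have h1 : HasDerivAt p (deriv p (t * z)) ((t:ℂ) * z) :=
      (hp.differentiableAt (isOpen_ball.mem_nhds (hmem t ht))).hasDerivAt
    have h2 : HasDerivAt (fun s : ℂ => s * z) z (t : ℂ) := by
      simpa using (hasDerivAt_id (t:ℂ)).mul_const z
    have h3 : HasDerivAt (fun s : ℂ => u * (p (s * z))⁻¹)
        (u * (-(deriv p (t * z) * z) / (p (t * z)) ^ 2)) (t:ℂ) :=
      ((HasDerivAt.comp (t:ℂ) h1 h2).fun_inv (hpne _ (hmem t ht))).const_mul u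
    exact h3.real_of_complex
  have hder2 : ∀ t ∈ Set.Icc (0:ℝ) 1, HasDerivAt (fun s : ℝ => B s - (u * (p (s * z))⁻¹).re)
      (B' t - (u * (-(deriv p (t * z) * z) / (p (t * z)) ^ 2)).re) t :=
    fun t ht => (hB t ht).sub (hder t ht)
  have hmono : MonotoneOn (fun s : ℝ => B s - (u * (p (s * z))⁻¹).re) (Set.Icc (0:ℝ) 1) := by
    apply monotoneOn_of_deriv_nonneg (convex_Icc 0 1)
    · exact fun t ht => (hder2 t ht).continuousAt.continuousWithinAt
    · exact fun t ht => (hder2 t (interior_subset ht)).differentiableAt.differentiableWithinAt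
    · intro t ht
      rw [(hder2 t (interior_subset ht)).deriv]
      have htI : t ∈ Set.Icc (0:ℝ) 1 := interior_subset ht
      rw [interior_Icc] at ht
      have h1 := hb t ht
      have h2 := heq _ (hmem t htI)
      have h3 : u * (1 - Complex.exp (ω (t * z))) =
          ((β * t : ℝ) : ℂ) * (u * (-(deriv p (t * z) * z) / (p (t * z)) ^ 2)) := by
        rw [← h2]; push_cast; ring
      rw [h3, Complex.re_ofReal_mul, ← mul_assoc] at h1
      have := le_of_mul_le_mul_left h1 (mul_pos hβ ht.1)
      linarith
  have := hmono (Set.left_mem_Icc.2 zero_le_one) (Set.right_mem_Icc.2 zero_le_one) zero_le_one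
  simp only [Complex.ofReal_zero, zero_mul, Complex.ofReal_one, one_mul] at this
  rw [mul_sub, Complex.sub_re]
  linarith

/-- Boundary exclusion. -/
lemma aux_excl (ζ q : ℂ) (hζ : ‖ζ‖ = 1) (hq : q * (1 + ζ * Complex.exp ζ) = 1)
    (h1 : ‖q - 1‖ * (1 + Real.exp 1) < Real.exp 1) (h2 : q.re ≤ 14 / 9) : False := by
  set ψ := ζ * Complex.exp ζ with hψ
  have hxy : ζ.re ^ 2 + ζ.im ^ 2 = 1 := by
    have := Complex.sq_norm ζ
    rw [Complex.normSq_apply, hζ] at this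
    linarith
  have hn : ‖ψ‖ = Real.exp ζ.re := by rw [hψ, norm_mul, hζ, one_mul, Complex.norm_exp]
  have hre : ψ.re = Real.exp ζ.re * (ζ.re * Real.cos ζ.im - ζ.im * Real.sin ζ.im) := by
    rw [hψ, Complex.mul_re, Complex.exp_re, Complex.exp_im]; ring
  have hne : 1 + ψ ≠ 0 := by
    intro h; rw [h] at hq; simp at hq
  have hnp : 0 < ‖1 + ψ‖ := norm_pos_iff.2 hne
  have hsq : ‖1 + ψ‖ ^ 2 = 1 + 2 * ψ.re + Real.exp ζ.re ^ 2 := by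
    rw [← hn, Complex.sq_norm, Complex.sq_norm, Complex.normSq_apply, Complex.normSq_apply]
    simp; ring
  have hkey := aux_key ζ.re ζ.im hxy
  rcases hkey with hk | hk
  · have e1 : ‖q - 1‖ * ‖1 + ψ‖ = Real.exp ζ.re := by
      rw [← norm_mul, ← hn, ← norm_neg ψ]
      congr 1
      linear_combination hq
    have e2 : Real.exp ζ.re * (1 + Real.exp 1) < Real.exp 1 * ‖1 + ψ‖ := by
      rw [← e1]; nlinarith
    have e3 := pow_lt_pow_left₀ e2 (by positivity) two_ne_zero
    rw [mul_pow, mul_pow, hsq, hre] at e3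
    linarith
  · have e1 : q.re * ‖1 + ψ‖ ^ 2 = 1 + ψ.re := by
      have : q = (1 + ψ)⁻¹ := eq_inv_of_mul_eq_one_left hq
      rw [this, Complex.inv_re, Complex.sq_norm, div_mul_cancel₀ _ (by simpa using hne)]
      simp
    have e2 : 1 + ψ.re ≤ 14 / 9 * ‖1 + ψ‖ ^ 2 := by
      rw [← e1]; gcongr
    rw [hsq, hre] at e2
    linarith

lemma aux_strict (w : ℂ) : HasStrictDerivAt (fun z : ℂ => 1 + z * Complex.exp z) ((1 + w) * Complex.exp w) w := by
  have := ((hasStrictDerivAt_id w).mul (Complex.hasStrictDerivAt_exp w)).const_add 1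
  convert! this using 1
  simp; ring

lemma aux_ne (w : ℂ) (hw : w ∈ ball (0:ℂ) 1) : (1 + w) * Complex.exp w ≠ 0 := by
  refine mul_ne_zero ?_ (Complex.exp_ne_zero _)
  intro h
  have : w = -1 := by linear_combination h
  rw [this] at hw
  simp at hw

open Topology Filter in
lemma aux_sub (p : ℂ → ℂ) (hp : DifferentiableOn ℂ p (ball (0 : ℂ) 1)) (hp0 : p 0 = 1)
    (hex : ∀ z ∈ ball (0:ℂ) 1, ∀ ζ : ℂ, ‖ζ‖ = 1 → p z ≠ 1 + ζ * Complex.exp ζ) :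
    Subordinate p (fun z => 1 + z * Complex.exp z) := by
  set f : ℂ → ℂ := fun z => 1 + z * Complex.exp z with hf
  have hfc : Continuous f := by fun_prop
  have hinj : ∀ a ∈ ball (0:ℂ) 1, ∀ b ∈ ball (0:ℂ) 1, f a = f b → a = b := by
    intro a ha b hb h
    exact aux_inj a b (by simpa using ha) (by simpa using hb) (add_left_cancel h)
  have hsub : p '' ball (0:ℂ) 1 ⊆ f '' ball (0:ℂ) 1 := by
    have hconn : IsPreconnected (p '' ball (0:ℂ) 1) :=
      (convex_ball (0:ℂ) 1).isPreconnected.image p hp.continuousOn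
    have hopen : IsOpen (f '' ball (0:ℂ) 1) := by
      rw [isOpen_iff_mem_nhds]
      rintro _ ⟨w, hw, rfl⟩
      rw [← (aux_strict w).map_nhds_eq (aux_ne w hw)]
      exact image_mem_map (isOpen_ball.mem_nhds hw)
    have hcl : IsClosed (f '' closedBall (0:ℂ) 1) :=
      ((isCompact_closedBall (0:ℂ) 1).image hfc).isClosed
    refine hconn.subset_left_of_subset_union hopen hcl.isOpen_compl ?_ ?_ ?_
    · rw [Set.disjoint_left]
      intro a ha hb
      exact hb (Set.image_mono ball_subset_closedBall ha)
    · rintro _ ⟨z, hz, rfl⟩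
      by_cases h : p z ∈ f '' closedBall (0:ℂ) 1
      · left
        obtain ⟨w, hw, hwz⟩ := h
        refine ⟨w, ?_, hwz⟩
        rw [mem_closedBall_zero_iff] at hw
        rw [mem_ball_zero_iff]
        exact lt_of_le_of_ne hw fun h1 => hex z hz w h1 hwz.symm
      · exact Or.inr h
    · exact ⟨1, ⟨0, by simp, hp0⟩, ⟨0, by simp, by simp [hf]⟩⟩
  have hch : ∀ z : ℂ, ∃ w : ℂ, z ∈ ball (0:ℂ) 1 → w ∈ ball (0:ℂ) 1 ∧ f w = p z := by
    intro z
    by_cases hz : z ∈ ball (0:ℂ) 1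
    · obtain ⟨w, hw, h⟩ := hsub ⟨z, hz, rfl⟩
      exact ⟨w, fun _ => ⟨hw, h⟩⟩
    · exact ⟨0, fun h => absurd h hz⟩
  choose ω hω using hch
  refine ⟨ω, ?_, ?_, fun z hz => (hω z hz).1, fun z hz => (hω z hz).2.symm⟩
  · rw [analyticOn_iff_differentiableOn isOpen_ball]
    intro z hz
    obtain ⟨hw, hwz⟩ := hω z hz
    have hs := aux_strict (ω z)
    have hne := aux_ne (ω z) hw
    have hpd : DifferentiableAt ℂ p z := hp.differentiableAt (isOpen_ball.mem_nhds hz)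
    set g := hs.localInverse _ _ _ hne with hg
    have hgd : HasStrictDerivAt g _ (f (ω z)) := hs.to_localInverse hne
    have hgr : ∀ᶠ x in 𝓝 (f (ω z)), f (g x) = x := hs.eventually_right_inverse hne
    have hgl : g (f (ω z)) = ω z := (hs.eventually_left_inverse hne).self_of_nhds
    rw [hwz] at hgd hgr hgl
    have hcomp : DifferentiableAt ℂ (g ∘ p) z := hgd.hasDerivAt.differentiableAt.comp z hpd
    have hev : ω =ᶠ[𝓝 z] g ∘ p := by
      have h1 := hpd.continuousAt.eventually hgr
      have h2 : ∀ᶠ x in 𝓝 z, (g ∘ p) x ∈ ball (0:ℂ) 1 :=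
        hcomp.continuousAt.eventually (isOpen_ball.mem_nhds (by simpa [hgl] using hw))
      filter_upwards [h1, h2, isOpen_ball.mem_nhds hz] with x hx1 hx2 hx3
      exact hinj _ (hω x hx3).1 _ hx2 ((hω x hx3).2.trans hx1.symm)
    exact (hcomp.congr_of_eventuallyEq hev).differentiableWithinAt
  · have h0 : (0:ℂ) ∈ ball (0:ℂ) 1 := by simp
    exact hinj _ (hω 0 h0).1 _ h0 ((hω 0 h0).2.trans (by simp [hf, hp0]))

/-- if `β ≥ ((e+1)/e)·Σ_{n≥1} 1/(n!·n)` and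
`1 + β·z·p'(z)/p(z)² ≺ e^z`, then `p ≺ 1 + z e^z`. -/
theorem stmt_19 (p : ℂ → ℂ) (hp : AnalyticOn ℂ p (ball (0 : ℂ) 1)) (hp0 : p 0 = 1)
    (hpne : ∀ z ∈ ball (0 : ℂ) 1, p z ≠ 0)
    (β : ℝ)
    (hβ : ((Real.exp 1 + 1) / Real.exp 1) *
      (∑' n : ℕ, 1 / ((Nat.factorial (n + 1) : ℝ) * ((n : ℝ) + 1))) ≤ β)
    (hsub : Subordinate (fun z => 1 + (β : ℂ) * z * deriv p z / (p z) ^ 2)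
      (fun z => Complex.exp z)) :
    Subordinate p (fun z => 1 + z * Complex.exp z) := by
  have hβ1 := aux_beta β hβ aux_summable
  have hβ0 : 0 < β := by linarith
  obtain ⟨ω, hωa, hω0, hωm, heq⟩ := hsub
  have hpd : DifferentiableOn ℂ p (ball (0:ℂ) 1) := hp.differentiableOn
  have hsch : ∀ w : ℂ, ‖w‖ < 1 → ‖ω w‖ ≤ ‖w‖ := fun w hw =>
    Complex.norm_le_norm_of_mapsTo_ball hωa.differentiableOn
      (fun x hx => ball_subset_closedBall (hωm x hx)) hω0 hw
  have hL1 : auxL 1 = ∑' n : ℕ, 1 / ((Nat.factorial (n + 1) : ℝ) * ((n : ℝ) + 1)) := by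
    simp [auxL]
  have hL0 : auxL 0 = 0 := by simp [auxL]
  have hE := Real.exp_pos 1
  have hLβ : (Real.exp 1 + 1) * auxL 1 ≤ Real.exp 1 * β := by
    rw [← hL1, div_mul_eq_mul_div, div_le_iff₀ hE] at hβ
    linarith
  refine aux_sub p hpd hp0 ?_
  intro z hz ζ hζ hpz
  have hzn : ‖z‖ < 1 := by simpa using hz
  have hωt : ∀ t ∈ Set.Ioo (0:ℝ) 1, ‖ω (t * z)‖ ≤ ‖z‖ * t := by
    intro t ht
    have e : ‖(t:ℂ) * z‖ = ‖z‖ * t := by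
      rw [norm_mul, Complex.norm_real, Real.norm_of_nonneg ht.1.le, mul_comm]
    rw [← e]
    apply hsch
    rw [e]
    nlinarith [ht.1, ht.2, norm_nonneg z]
  refine aux_excl ζ (p z)⁻¹ hζ ?_ ?_ ?_
  · rw [← hpz]; exact inv_mul_cancel₀ (hpne z hz)
  · have key : ‖(p z)⁻¹ - 1‖ ≤ ‖z‖ / β * auxL 1 := by
      by_cases h0 : (p z)⁻¹ - 1 = 0
      · rw [h0, norm_zero, hL1]
        exact mul_nonneg (by positivity) (tsum_nonneg fun n => by positivity)
      set d := (p z)⁻¹ - 1 with hd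
      have hdn : 0 < ‖d‖ := norm_pos_iff.2 h0
      set u : ℂ := (starRingEnd ℂ) d / (‖d‖ : ℂ) with hu
      have hun : ‖u‖ = 1 := by
        rw [hu, norm_div, RCLike.norm_conj, Complex.norm_real, norm_norm, div_self hdn.ne']
      have hud : u * d = (‖d‖ : ℂ) := by
        have hdc : (‖d‖ : ℂ) ≠ 0 := by exact_mod_cast hdn.ne'
        rw [hu, div_mul_eq_mul_div, mul_comm, Complex.mul_conj, Complex.normSq_eq_norm_sq,
          div_eq_iff hdc]
        push_cast; ring
      have := aux_ray p ω hpd hpne β hβ0 heq z hz u (fun t => ‖z‖ / β * auxL t)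
        (fun t => ‖z‖ / β * ∑' n : ℕ, t ^ n / (Nat.factorial (n + 1) : ℝ))
        (fun t ht => (auxL_deriv t (by rw [abs_of_nonneg ht.1]; linarith [ht.2])).const_mul _)
        (fun t ht => by
          have h1 := aux_norm _ t ‖z‖ (norm_nonneg z) hzn.le (hωt t ht)
          have h2 := auxL_sum t
          calc _ ≤ ‖u * (1 - Complex.exp (ω (t * z)))‖ := Complex.re_le_norm _
            _ = ‖1 - Complex.exp (ω (t * z))‖ := by rw [norm_mul, hun, one_mul]
            _ ≤ _ := h1
            _ = _ := by rw [← h2]; field_simp)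
      rw [hp0, inv_one, ← hd, hud, Complex.ofReal_re, hL0] at this
      simpa using this
    have h3 : ‖(p z)⁻¹ - 1‖ * β ≤ ‖z‖ * auxL 1 := by
      rw [div_mul_eq_mul_div, le_div_iff₀ hβ0] at key
      exact key
    have h4 : (‖(p z)⁻¹ - 1‖ * (1 + Real.exp 1)) * β ≤ (‖z‖ * Real.exp 1) * β := by
      have a := mul_le_mul_of_nonneg_right h3 (by positivity : 0 ≤ 1 + Real.exp 1)
      have b := mul_le_mul_of_nonneg_left hLβ (norm_nonneg z)
      linarith
    have h5 := le_of_mul_le_mul_right h4 hβ0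
    nlinarith
  · have := aux_ray p ω hpd hpne β hβ0 heq z hz 1 (fun t => t / β) (fun _ => 1 / β)
      (fun t _ => (hasDerivAt_id t).div_const β)
      (fun t ht => by
        rw [one_mul]
        have := aux_re (ω (t * z)) t ht.2.le ((hωt t ht).trans (by nlinarith [ht.1]))
        refine this.trans (le_of_eq ?_)
        field_simp)
    rw [hp0, one_mul, inv_one, Complex.sub_re, Complex.one_re] at this
    have h1 : 1 / β ≤ 5 / 9 := by
      rw [div_le_div_iff₀ hβ0 (by norm_num)]; linarith
    simp only [zero_div, sub_zero] at this
    linarith
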